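/- Let p ≥ 2 and n = 3p+1, and for i ∈ ℤ let ī denote the unique element of [n] with ī ≡ i (mod n). Let Σ = ⟨{ {(i−(p−1))¯, ī, (i+(p+1))¯} : i=1,…,n }⟩; for i=1,…,n and j=1,…,p−2 let Δ(i,j) = ⟨{(i−j)¯, ī, (i+(2p−j))¯}, {(1+i+p)¯, (i+(2p−j))¯, ī}⟩; and for i=1,…,p let Δ(i,∞) = ⟨{ī, (i+p)¯, (i+2p)¯}, {(i+p)¯, (i+2p)¯, (i+3p)¯}⟩. Set Δ̂ = Σ ∪ (⋃ Δ(i,j)) ∪ (⋃ Δ(i,∞)) and M = (1/3)·(C(n−2,2) − 1). Then Δ̂ is Buchsbaum, link-acyclic, h(Δ̂) = (1, n−3, 3M, −M), and {p, n} ∉ Δ̂. -/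

import Mathlib

open Finset

noncomputable section

/-- `Δ` is a simplicial complex on `[n] = {1,…,n}`: a collection of subsets of `[n]`,
closed under taking subsets, containing every singleton `{i}` for `i ∈ [n]`. -/
def IsComplexOn (n : ℕ) (Δ : Finset (Finset ℕ)) : Prop :=
  (∀ F ∈ Δ, ∀ G ⊆ F, G ∈ Δ) ∧
  (∀ F ∈ Δ, ∀ i ∈ F, i ∈ Finset.Icc 1 n) ∧
  (∀ i ∈ Finset.Icc 1 n, ({i} : Finset ℕ) ∈ Δ)

/-- a simplicial complex whose vertex set is contained in `[n]`:
a downward closed collection of subsets of `[n]`. -/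
def IsComplexIn (n : ℕ) (Δ : Finset (Finset ℕ)) : Prop :=
  (∀ F ∈ Δ, ∀ G ⊆ F, G ∈ Δ) ∧ (∀ F ∈ Δ, ∀ i ∈ F, i ∈ Finset.Icc 1 n)

/-- the faces of `Δ` with `m` vertices -/
def facesOf (Δ : Finset (Finset ℕ)) (m : ℕ) : Finset (Finset ℕ) :=
  Δ.filter fun F => F.card = m

/-- `fVec Δ j = f_{j-1}(Δ)`, the number of faces of `Δ` with `j` vertices;
by convention `f_{-1}(Δ) = 1`. -/
def fVec (Δ : Finset (Finset ℕ)) (j : ℕ) : ℤ :=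
  if j = 0 then 1 else ((facesOf Δ j).card : ℤ)

/-- the `h`-vector of a `(d-1)`-dimensional complex, defined by
`∑ f_{i-1} (x-1)^{d-i} = ∑ h_i x^{d-i}`, i.e.
`h_i = ∑_{j=0}^{i} (-1)^{i-j} C(d-j, i-j) f_{j-1}`. -/
def hVec (d : ℕ) (Δ : Finset (Finset ℕ)) (i : ℕ) : ℤ :=
  ∑ j ∈ Finset.range (i + 1),
    (-1 : ℤ) ^ (i - j) * ((d - j).choose (i - j) : ℤ) * fVec Δ j

/-- the dimension `max {k : f_k(Δ) ≠ 0}` of `Δ`, as an integer -/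
def dimZ (Δ : Finset (Finset ℕ)) : ℤ := ((Δ.sup Finset.card : ℕ) : ℤ) - 1

/-- the link `lk_Δ(F) = {G : G ∩ F = ∅, G ∪ F ∈ Δ}` -/
def link (Δ : Finset (Finset ℕ)) (F : Finset ℕ) : Finset (Finset ℕ) :=
  Δ.filter fun G => Disjoint G F ∧ G ∪ F ∈ Δ

variable (K : Type) [Field K]

/-- the simplicial boundary operator on formal `K`-linear combinations of
finite subsets of `ℕ` (vertices ordered by the order on `ℕ`):
`∂ F = ∑_{v ∈ F} (-1)^{#{u ∈ F : u < v}} (F \ {v})`. -/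
def bdry : (Finset ℕ →₀ K) →ₗ[K] (Finset ℕ →₀ K) :=
  Finsupp.lsum K fun F => LinearMap.toSpanSingleton K (Finset ℕ →₀ K)
    (∑ v ∈ F, ((-1 : K) ^ ((F.filter fun u => u < v).card)) • Finsupp.single (F.erase v) (1 : K))

/-- the space of simplicial `K`-chains of `Δ` spanned by the faces with `m` vertices
(for `m = 0` this is the span of the empty face, giving *reduced* homology) -/
def chains (Δ : Finset (Finset ℕ)) (m : ℕ) : Submodule K (Finset ℕ →₀ K) :=
  Submodule.span K ((fun F => Finsupp.single F (1 : K)) '' (facesOf Δ m : Set (Finset ℕ)))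

/-- the dimension of the reduced homology of `Δ` at faces of cardinality `m`:
`dim (ker ∂ ∩ C_m) - dim (∂ C_{m+1})` -/
def homDim (Δ : Finset (Finset ℕ)) (m : ℕ) : ℕ :=
  Module.finrank K ↥(chains K Δ m ⊓ LinearMap.ker (bdry K))
    - Module.finrank K ↥((chains K Δ (m + 1)).map (bdry K))

/-- the reduced Betti number `β_i(Δ; K) = dim_K H̃_i(Δ; K)` for `i : ℤ` -/
def betti (Δ : Finset (Finset ℕ)) (i : ℤ) : ℕ :=
  if 0 ≤ i + 1 then homDim K Δ (i + 1).toNat else 0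

/-- all facets (maximal faces) of `Δ` have the same cardinality -/
def IsPure (Δ : Finset (Finset ℕ)) : Prop :=
  ∀ F ∈ Δ, (∀ G ∈ Δ, F ⊆ G → F = G) → F.card = Δ.sup Finset.card

/-- `Δ` is Cohen–Macaulay (over `K`): for every face `F ∈ Δ` (including `∅`),
`β_i(lk_Δ(F)) = 0` for all `i ≠ dim Δ - |F|`. -/
def IsCohenMacaulay (Δ : Finset (Finset ℕ)) : Prop :=
  ∀ F ∈ Δ, ∀ i : ℤ, i ≠ dimZ Δ - F.card → betti K (link Δ F) i = 0

/-- `Δ` is Buchsbaum (over `K`): `Δ` is pure and the link of every vertex is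
Cohen–Macaulay. -/
def IsBuchsbaum (Δ : Finset (Finset ℕ)) : Prop :=
  IsPure Δ ∧ ∀ v : ℕ, ({v} : Finset ℕ) ∈ Δ → IsCohenMacaulay K (link Δ {v})

/-- `Δ` is connected: any two vertices are joined by a path of edges of `Δ` -/
def IsConnectedComplex (Δ : Finset (Finset ℕ)) : Prop :=
  ∀ u v : ℕ, ({u} : Finset ℕ) ∈ Δ → ({v} : Finset ℕ) ∈ Δ →
    Relation.ReflTransGen (fun a b : ℕ => a ≠ b ∧ ({a, b} : Finset ℕ) ∈ Δ) u v

/-- `Δ` is link-acyclic: `β_i(lk_Δ(v)) = 0` for every vertex `v` of `Δ` and every `i` -/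
def IsLinkAcyclic (Δ : Finset (Finset ℕ)) : Prop :=
  ∀ v : ℕ, ({v} : Finset ℕ) ∈ Δ → ∀ i : ℤ, betti K (link Δ {v}) i = 0

/-- `Δ` is `2`-dimensional with `h`-vector `(a, b, c, e)` -/
def hVector3 (Δ : Finset (Finset ℕ)) (a b c e : ℤ) : Prop :=
  hVec 3 Δ 0 = a ∧ hVec 3 Δ 1 = b ∧ hVec 3 Δ 2 = c ∧ hVec 3 Δ 3 = e

/-- `macaulay2 a = a^⟨2⟩`: if `a = C(b,2) + r` is the (greedy) `2`-nd Macaulay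
representation (`b` maximal with `C(b,2) ≤ a`, `0 ≤ r < b`, `r = C(r,1)`), then
`a^⟨2⟩ = C(b+1,3) + C(r+1,2)`, and `0^⟨2⟩ = 0`. -/
def macaulay2 (a : ℕ) : ℕ :=
  if a = 0 then 0
  else
    (Nat.findGreatest (fun t => t.choose 2 ≤ a) (a + 2) + 1).choose 3
      + (a - (Nat.findGreatest (fun t => t.choose 2 ≤ a) (a + 2)).choose 2 + 1).choose 2

/-- `modRep n i = ī`, the unique element of `[n] = {1,…,n}` congruent to `i` mod `n` -/
def modRep (n : ℕ) (i : ℤ) : ℕ := ((i - 1) % (n : ℤ)).toNat + 1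


/-- `Σ` for `n = 3p+1`: generated by `{(i-(p-1))¯, ī, (i+(p+1))¯}`, `i = 1,…,n` -/
def SigmaC (p : ℕ) : Finset (Finset ℕ) :=
  (Finset.Icc 1 (3 * p + 1)).biUnion fun i =>
    ({modRep (3 * p + 1) ((i : ℤ) - ((p : ℤ) - 1)), modRep (3 * p + 1) (i : ℤ),
      modRep (3 * p + 1) ((i : ℤ) + ((p : ℤ) + 1))} : Finset ℕ).powerset

/-- `Δ(i,j)` for `n = 3p+1`, `j = 1,…,p-2`: generated by `{(i-j)¯, ī, (i+(2p-j))¯}`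
and `{(1+i+p)¯, (i+(2p-j))¯, ī}` -/
def DeltaC (p i j : ℕ) : Finset (Finset ℕ) :=
  ({modRep (3 * p + 1) ((i : ℤ) - j), modRep (3 * p + 1) (i : ℤ),
    modRep (3 * p + 1) ((i : ℤ) + (2 * (p : ℤ) - j))} : Finset ℕ).powerset ∪
  ({modRep (3 * p + 1) (1 + (i : ℤ) + p),
    modRep (3 * p + 1) ((i : ℤ) + (2 * (p : ℤ) - j)),
    modRep (3 * p + 1) (i : ℤ)} : Finset ℕ).powerset

/-- `Δ(i,∞)` for `n = 3p+1`, `i = 1,…,p`: generated by `{ī, (i+p)¯, (i+2p)¯}` and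
`{(i+p)¯, (i+2p)¯, (i+3p)¯}` -/
def DeltaCinf (p i : ℕ) : Finset (Finset ℕ) :=
  ({modRep (3 * p + 1) (i : ℤ), modRep (3 * p + 1) ((i : ℤ) + p),
    modRep (3 * p + 1) ((i : ℤ) + 2 * p)} : Finset ℕ).powerset ∪
  ({modRep (3 * p + 1) ((i : ℤ) + p), modRep (3 * p + 1) ((i : ℤ) + 2 * p),
    modRep (3 * p + 1) ((i : ℤ) + 3 * p)} : Finset ℕ).powerset

/-- `Δ̂ = Σ ∪ (⋃_{i,j} Δ(i,j)) ∪ (⋃_i Δ(i,∞))` for `n = 3p+1` -/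
def hatDeltaC (p : ℕ) : Finset (Finset ℕ) :=
  SigmaC p ∪ ((Finset.Icc 1 (3 * p + 1)) ×ˢ (Finset.Icc 1 (p - 2))).biUnion
    (fun q => DeltaC p q.1 q.2) ∪ (Finset.Icc 1 p).biUnion (fun i => DeltaCinf p i)

end

section Homology

variable {K : Type} [Field K] {Δ : Finset (Finset ℕ)}

lemma bdry_single (F : Finset ℕ) :
    bdry K (Finsupp.single F 1) =
      ∑ v ∈ F, ((-1 : K) ^ ((F.filter fun u => u < v).card)) • Finsupp.single (F.erase v) (1 : K) := by
  simp [bdry]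

lemma bdry_single_singleton (u : ℕ) :
    bdry K (Finsupp.single {u} 1) = Finsupp.single ∅ 1 := by
  simp [bdry_single, Finset.filter_singleton]

lemma bdry_single_pair {a b : ℕ} (h : a < b) :
    bdry K (Finsupp.single {a, b} 1) = Finsupp.single {b} 1 - Finsupp.single {a} 1 := by
  have h₁ : ({a, b} : Finset ℕ).erase a = {b} := by
    ext x; simp only [mem_erase, mem_insert, mem_singleton]; omega
  have h₂ : ({a, b} : Finset ℕ).erase b = {a} := by
    ext x; simp only [mem_erase, mem_insert, mem_singleton]; omega
  have h₃ : ({a, b} : Finset ℕ).filter (fun u => u < a) = ∅ := by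
    ext x; simp only [mem_filter, mem_insert, mem_singleton, notMem_empty]; grind
  have h₄ : ({a, b} : Finset ℕ).filter (fun u => u < b) = {a} := by
    ext x; simp only [mem_filter, mem_insert, mem_singleton]; grind
  rw [bdry_single, Finset.sum_pair h.ne, h₁, h₂, h₃, h₄]
  simp [sub_eq_add_neg]

lemma single_mem_chains {F : Finset ℕ} (hF : F ∈ Δ) :
    Finsupp.single F (1 : K) ∈ chains K Δ F.card :=
  Submodule.subset_span ⟨F, by simp [facesOf, hF], rfl⟩

instance finiteDimensional_chains (m : ℕ) : FiniteDimensional K (chains K Δ m) :=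
  FiniteDimensional.span_of_finite K ((facesOf Δ m).finite_toSet.image _)

lemma finrank_chains (m : ℕ) : Module.finrank K (chains K Δ m) = (facesOf Δ m).card := by
  have hli : LinearIndependent K
      (fun F : (facesOf Δ m : Set (Finset ℕ)) => Finsupp.single (F : Finset ℕ) (1 : K)) :=
    (Finsupp.linearIndependent_single_one K (Finset ℕ)).comp _ Subtype.val_injective
  have h := finrank_span_eq_card hli
  rw [chains, Set.image_eq_range, h]
  simp

lemma finrank_map_add_finrank_inf_ker (m : ℕ) :
    Module.finrank K ((chains K Δ m).map (bdry K))
      + Module.finrank K ↥(chains K Δ m ⊓ LinearMap.ker (bdry K)) = (facesOf Δ m).card := by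
  have h := LinearMap.finrank_range_add_finrank_ker (K := K)
    (V := chains K Δ m) (V₂ := Finset ℕ →₀ K) ((bdry K).domRestrict (chains K Δ m))
  rw [LinearMap.range_domRestrict, LinearMap.ker_domRestrict, finrank_chains,
    ← Submodule.finrank_map_subtype_eq, Submodule.map_comap_subtype] at h
  exact h

lemma betti_natCast_sub_one (m : ℕ) : betti K Δ ((m : ℤ) - 1) = homDim K Δ m := by
  rw [betti, if_pos (by omega), sub_add_cancel, Int.toNat_natCast]

lemma betti_eq_zero_of_facesOf {m : ℕ} (h : facesOf Δ m = ∅) : betti K Δ ((m : ℤ) - 1) = 0 := by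
  have := finrank_map_add_finrank_inf_ker (K := K) (Δ := Δ) m
  simp only [h, card_empty, Nat.add_eq_zero_iff] at this
  rw [betti_natCast_sub_one, homDim, this.2, Nat.zero_sub]

lemma betti_eq_zero_of_lt {i : ℤ} (h : i < -1) : betti K Δ i = 0 := by
  rw [betti, if_neg (by omega)]

lemma finrank_map_chains_one_pos {r : ℕ} (hr : {r} ∈ Δ) :
    1 ≤ Module.finrank K ((chains K Δ 1).map (bdry K)) := by
  have hmem : Finsupp.single ∅ 1 ∈ (chains K Δ 1).map (bdry K) := by
    rw [← bdry_single_singleton r]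
    refine Submodule.mem_map_of_mem ?_
    simpa using single_mem_chains (K := K) hr
  rw [Nat.one_le_iff_ne_zero, Ne, Submodule.finrank_eq_zero, Submodule.eq_bot_iff]
  exact fun h => by simpa using h _ hmem

lemma card_facesOf_zero_le : (facesOf Δ 0).card ≤ 1 := by
  rw [Finset.card_le_one]
  intro a ha b hb
  simp only [facesOf, mem_filter, card_eq_zero] at ha hb
  rw [ha.2, hb.2]

lemma betti_neg_one_eq_zero {r : ℕ} (hr : {r} ∈ Δ) : betti K Δ (-1) = 0 := by
  have h₁ := finrank_map_add_finrank_inf_ker (K := K) (Δ := Δ) 0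
  have h₂ := finrank_map_chains_one_pos (K := K) hr
  have h₃ := card_facesOf_zero_le (Δ := Δ)
  rw [show (-1 : ℤ) = ((0 : ℕ) : ℤ) - 1 from rfl, betti_natCast_sub_one, homDim, zero_add]
  omega

/-- The vertices of `Δ` are all joined to `r` by paths of edges of `Δ`. -/
def ReachesRoot (Δ : Finset (Finset ℕ)) (r : ℕ) : Prop :=
  ∀ u : ℕ, {u} ∈ Δ → Relation.ReflTransGen (fun a b : ℕ => {a, b} ∈ Δ) u r

lemma single_sub_single_mem {a b : ℕ} (h : {a, b} ∈ Δ) :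
    Finsupp.single {a} (1 : K) - Finsupp.single {b} 1 ∈ (chains K Δ 2).map (bdry K) := by
  rcases lt_trichotomy a b with hab | rfl | hab
  · rw [← neg_sub, neg_mem_iff, ← bdry_single_pair hab]
    refine Submodule.mem_map_of_mem ?_
    simpa [Finset.card_pair hab.ne] using single_mem_chains (K := K) h
  · simp
  · rw [← bdry_single_pair hab]
    refine Submodule.mem_map_of_mem ?_
    rw [Finset.pair_comm] at h
    simpa [Finset.card_pair hab.ne] using single_mem_chains (K := K) h

variable (K) in
lemma card_vertices_le {r : ℕ} (hc : ReachesRoot Δ r) :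
    (facesOf Δ 1).card ≤ Module.finrank K ((chains K Δ 2).map (bdry K)) + 1 := by
  have hle : chains K Δ 1 ≤
      (chains K Δ 2).map (bdry K) ⊔ Submodule.span K {Finsupp.single {r} (1 : K)} := by
    rw [chains, Submodule.span_le]
    rintro _ ⟨F, hF, rfl⟩
    simp only [facesOf, coe_filter, Set.mem_ofPred_eq, card_eq_one] at hF
    obtain ⟨hF, u, rfl⟩ := hF
    have hu := hc u hF
    clear hF
    induction hu using Relation.ReflTransGen.head_induction_on with
    | refl => exact Submodule.mem_sup_right (Submodule.mem_span_singleton_self _)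
    | head hab _ ih =>
      simpa using add_mem (Submodule.mem_sup_left (single_sub_single_mem (K := K) hab)) ih
  have := Submodule.finrank_mono hle
  rw [finrank_chains] at this
  refine this.trans ((Submodule.finrank_add_le_finrank_add_finrank _ _).trans ?_)
  gcongr
  exact (finrank_span_le_card _).trans (by simp)

lemma card_vertices_le_card_edges {r : ℕ} (hc : ReachesRoot Δ r) :
    (facesOf Δ 1).card ≤ (facesOf Δ 2).card + 1 := by
  have h₁ := card_vertices_le ℚ hc
  have h₂ := finrank_map_add_finrank_inf_ker (K := ℚ) (Δ := Δ) 2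
  omega

lemma betti_eq_zero_of_tree {r : ℕ} (hr : {r} ∈ Δ) (hc : ReachesRoot Δ r)
    (hd : ∀ F ∈ Δ, F.card ≤ 2) (hcard : (facesOf Δ 2).card + 1 ≤ (facesOf Δ 1).card) (i : ℤ) :
    betti K Δ i = 0 := by
  have h₀ := finrank_map_chains_one_pos (K := K) hr
  have h₁ := finrank_map_add_finrank_inf_ker (K := K) (Δ := Δ) 1
  have h₂ := finrank_map_add_finrank_inf_ker (K := K) (Δ := Δ) 2
  have h₃ := card_vertices_le K hc
  rcases lt_or_ge i (-1) with hi | hi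
  · exact betti_eq_zero_of_lt hi
  obtain ⟨m, rfl⟩ : ∃ m : ℕ, i = (m : ℤ) - 1 := ⟨(i + 1).toNat, by omega⟩
  match m with
  | 0 => exact betti_neg_one_eq_zero hr
  | 1 => rw [betti_natCast_sub_one, homDim, one_add_one_eq_two]; omega
  | 2 => rw [betti_natCast_sub_one, homDim]; omega
  | m + 3 =>
    refine betti_eq_zero_of_facesOf ?_
    rw [facesOf, Finset.filter_eq_empty_iff]
    intro F hF hF'
    have := hd F hF
    omega

end Homology

section PureSurface

variable {Δ : Finset (Finset ℕ)}

lemma mem_link {F G : Finset ℕ} (hΔ : ∀ F ∈ Δ, ∀ G ⊆ F, G ∈ Δ) :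
    G ∈ link Δ F ↔ Disjoint G F ∧ G ∪ F ∈ Δ := by
  simp only [link, mem_filter, and_iff_right_iff_imp, and_imp]
  exact fun _ h => hΔ _ h _ subset_union_left

lemma link_subset_closed (hΔ : ∀ F ∈ Δ, ∀ G ⊆ F, G ∈ Δ) (F : Finset ℕ) :
    ∀ A ∈ link Δ F, ∀ B ⊆ A, B ∈ link Δ F := by
  intro A hA B hB
  rw [mem_link hΔ] at hA ⊢
  exact ⟨hA.1.mono_left hB, hΔ _ hA.2 _ (union_subset_union_left hB)⟩

lemma link_empty : link Δ ∅ = Δ := by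
  simp [link]

lemma card_facesOf_link_singleton (hΔ : ∀ F ∈ Δ, ∀ G ⊆ F, G ∈ Δ) (v m : ℕ) :
    (facesOf (link Δ {v}) m).card = ((facesOf Δ (m + 1)).filter fun F => v ∈ F).card := by
  refine Finset.card_nbij' (insert v) (fun F => F.erase v) ?_ ?_ ?_ ?_
  · intro G hG
    simp only [facesOf, coe_filter, mem_link hΔ, disjoint_singleton_right, Set.mem_ofPred_eq,
      mem_filter, union_singleton] at hG ⊢
    refine ⟨⟨hG.1.2, ?_⟩, mem_insert_self _ _⟩
    rw [card_insert_of_notMem hG.1.1, hG.2]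
  · intro F hF
    simp only [facesOf, coe_filter, mem_link hΔ, disjoint_singleton_right, Set.mem_ofPred_eq,
      mem_filter, union_singleton] at hF ⊢
    refine ⟨⟨notMem_erase _ _, ?_⟩, ?_⟩
    · rw [insert_erase hF.2]; exact hF.1.1
    · rw [card_erase_of_mem hF.2, hF.1.2, Nat.add_sub_cancel]
  · intro G hG
    simp only [facesOf, coe_filter, mem_link hΔ, disjoint_singleton_right,
      Set.mem_ofPred_eq] at hG
    exact erase_insert hG.1.1
  · intro F hF
    simp only [coe_filter, Set.mem_ofPred_eq] at hF
    exact insert_erase hF.2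

lemma sum_card_facesOf_link {V : Finset ℕ} (hΔ : ∀ F ∈ Δ, ∀ G ⊆ F, G ∈ Δ)
    (hV : ∀ F ∈ Δ, F ⊆ V) (m : ℕ) :
    ∑ v ∈ V, (facesOf (link Δ {v}) m).card = (m + 1) * (facesOf Δ (m + 1)).card := by
  simp_rw [card_facesOf_link_singleton hΔ]
  have h := Finset.sum_card_bipartiteAbove_eq_sum_card_bipartiteBelow
    (s := V) (t := facesOf Δ (m + 1)) (fun v F => v ∈ F)
  simp only [bipartiteAbove, bipartiteBelow] at h
  rw [h, Finset.sum_congr rfl (g := fun _ => m + 1), Finset.sum_const, smul_eq_mul, mul_comm]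
  intro F hF
  rw [facesOf, mem_filter] at hF
  rw [Finset.filter_mem_eq_inter, Finset.inter_eq_right.2 (hV F hF.1), hF.2]

lemma sup_card_eq {m : ℕ} {T : Finset ℕ} (hT : T ∈ Δ) (hTm : T.card = m)
    (hm : ∀ F ∈ Δ, F.card ≤ m) : Δ.sup Finset.card = m :=
  le_antisymm (Finset.sup_le hm) (hTm ▸ Finset.le_sup (f := Finset.card) hT)

lemma facesOf_eq_empty {m k : ℕ} (hm : ∀ F ∈ Δ, F.card ≤ m) (hk : m < k) : facesOf Δ k = ∅ := by
  rw [facesOf, Finset.filter_eq_empty_iff]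
  intro F hF hF'
  have := hm F hF
  omega

lemma betti_eq_zero_of_card_le {K : Type} [Field K] {m : ℕ} (hm : ∀ F ∈ Δ, F.card ≤ m) {i : ℤ}
    (hi : (m : ℤ) ≤ i) : betti K Δ i = 0 := by
  obtain ⟨k, rfl⟩ : ∃ k : ℕ, i = (k : ℤ) - 1 := ⟨(i + 1).toNat, by omega⟩
  exact betti_eq_zero_of_facesOf (facesOf_eq_empty hm (by omega))

lemma card_add_card_le_of_mem_link {m : ℕ} (hm : ∀ F ∈ Δ, F.card ≤ m) {F G : Finset ℕ}
    (hG : G ∈ link Δ F) : G.card + F.card ≤ m := by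
  rw [link, mem_filter] at hG
  rw [← card_union_of_disjoint hG.2.1]
  exact hm _ hG.2.2

/-- An acyclic one-dimensional complex in which every face lies in an edge is Cohen–Macaulay. -/
lemma isCohenMacaulay_of_acyclic_graph {K : Type} [Field K]
    (hΔ : ∀ F ∈ Δ, ∀ G ⊆ F, G ∈ Δ) (hd : ∀ F ∈ Δ, F.card ≤ 2)
    (hpure : ∀ F ∈ Δ, ∃ G ∈ Δ, F ⊆ G ∧ G.card = 2) (hacyc : ∀ i, betti K Δ i = 0) :
    IsCohenMacaulay K Δ := by
  intro F hF i hi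
  obtain ⟨G, hG, hFG, hG2⟩ := hpure F hF
  rw [dimZ, sup_card_eq hG hG2 hd] at hi
  rcases lt_or_ge i (-1) with hi' | hi'
  · exact betti_eq_zero_of_lt hi'
  have hlink : ∀ A ∈ link Δ F, A.card ≤ 2 - F.card := fun A hA => by
    have := card_add_card_le_of_mem_link hd hA
    omega
  have hF2 := hd F hF
  obtain h | h | h : F.card = 0 ∨ F.card = 1 ∨ F.card = 2 := by omega
  · rw [card_eq_zero.1 h, link_empty]
    exact hacyc i
  · rcases hi'.eq_or_lt with rfl | hi''
    · have hsd : (G \ F).card = 1 := by rw [card_sdiff_of_subset hFG]; omega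
      obtain ⟨r, hr⟩ := card_eq_one.1 hsd
      refine betti_neg_one_eq_zero (r := r) ?_
      rw [← hr, mem_link hΔ, sdiff_union_of_subset hFG]
      exact ⟨sdiff_disjoint, hG⟩
    · exact betti_eq_zero_of_card_le hlink (by omega)
  · exact betti_eq_zero_of_card_le hlink (by omega)

/-- If all vertex links of a pure two-dimensional complex are connected and there are at most as
many triangles as there would be if the links were trees, then the links are trees. -/
lemma card_facesOf_link_of_connected {V : Finset ℕ} (hΔ : ∀ F ∈ Δ, ∀ G ⊆ F, G ∈ Δ)
    (hV : ∀ F ∈ Δ, F ⊆ V) (hconn : ∀ v ∈ V, ∃ r, ReachesRoot (link Δ {v}) r)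
    (hcard : 3 * (facesOf Δ 3).card + V.card ≤ 2 * (facesOf Δ 2).card) :
    3 * (facesOf Δ 3).card + V.card = 2 * (facesOf Δ 2).card ∧
      ∀ v ∈ V, (facesOf (link Δ {v}) 1).card = (facesOf (link Δ {v}) 2).card + 1 := by
  have hle : ∀ v ∈ V, (facesOf (link Δ {v}) 1).card ≤ (facesOf (link Δ {v}) 2).card + 1 :=
    fun v hv => let ⟨_, hr⟩ := hconn v hv; card_vertices_le_card_edges hr
  have h₁ := sum_card_facesOf_link hΔ hV 1
  rw [one_add_one_eq_two] at h₁
  have h₂ : ∑ v ∈ V, ((facesOf (link Δ {v}) 2).card + 1)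
      = 3 * (facesOf Δ 3).card + V.card := by
    rw [sum_add_distrib, sum_card_facesOf_link hΔ hV 2, ← card_eq_sum_ones]
  have h₃ := Finset.sum_le_sum hle
  have h₄ : 3 * (facesOf Δ 3).card + V.card = 2 * (facesOf Δ 2).card := by omega
  exact ⟨h₄, (Finset.sum_eq_sum_iff_of_le hle).1 (by omega)⟩

lemma isBuchsbaum_and_isLinkAcyclic (K : Type) [Field K] {V : Finset ℕ}
    (hΔ : ∀ F ∈ Δ, ∀ G ⊆ F, G ∈ Δ) (hV : ∀ F ∈ Δ, F ⊆ V)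
    (hpure : ∀ F ∈ Δ, ∃ G ∈ Δ, F ⊆ G ∧ G.card = 3) (hd : ∀ F ∈ Δ, F.card ≤ 3)
    (hconn : ∀ v ∈ V, ∃ r, ReachesRoot (link Δ {v}) r ∧ {r} ∈ link Δ {v})
    (hcard : 3 * (facesOf Δ 3).card + V.card ≤ 2 * (facesOf Δ 2).card) :
    IsBuchsbaum K Δ ∧ IsLinkAcyclic K Δ := by
  have htree := (card_facesOf_link_of_connected hΔ hV
    (fun v hv => (hconn v hv).imp fun _ h => h.1) hcard).2
  have hd' : ∀ v, ∀ F ∈ link Δ {v}, F.card ≤ 2 := fun v F hF => by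
    have := card_add_card_le_of_mem_link hd hF
    rw [card_singleton] at this
    omega
  have hacyc : IsLinkAcyclic K Δ := by
    intro v hv i
    have hvV : v ∈ V := hV _ hv (mem_singleton_self v)
    obtain ⟨r, hr, hr'⟩ := hconn v hvV
    exact betti_eq_zero_of_tree hr' hr (hd' v) (htree v hvV).ge i
  refine ⟨⟨?_, ?_⟩, hacyc⟩
  · intro F hF hmax
    obtain ⟨G, hG, hFG, hG3⟩ := hpure F hF
    rw [hmax G hG hFG, hG3, sup_card_eq hG hG3 hd]
  · intro v hv
    refine isCohenMacaulay_of_acyclic_graph (link_subset_closed hΔ _) (hd' v) ?_ (hacyc v hv)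
    intro F hF
    rw [mem_link hΔ] at hF
    obtain ⟨G, hG, hFG, hG3⟩ := hpure _ hF.2
    have hvG : {v} ⊆ G := subset_union_right.trans hFG
    refine ⟨G \ {v}, ?_, ?_, ?_⟩
    · rw [mem_link hΔ, sdiff_union_of_subset hvG]
      exact ⟨sdiff_disjoint, hG⟩
    · exact subset_sdiff.2 ⟨subset_union_left.trans hFG, hF.1⟩
    · rw [card_sdiff_of_subset hvG, hG3, card_singleton]

end PureSurface

section Residues

variable {p : ℕ}

lemma modRep_add_mul (n : ℕ) (a k : ℤ) : modRep n (a + k * n) = modRep n a := by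
  have h : a + k * n - 1 = a - 1 + k * n := by ring
  rw [modRep, h, Int.add_mul_emod_self_right, modRep]

lemma modRep_natCast {n v : ℕ} (h₁ : 1 ≤ v) (h₂ : v ≤ n) : modRep n v = v := by
  rw [modRep, Int.emod_eq_of_lt (by omega) (by omega)]
  omega

lemma modRep_mem_Icc {n : ℕ} (hn : 0 < n) (a : ℤ) : modRep n a ∈ Finset.Icc 1 n := by
  have h₁ := Int.emod_nonneg (a - 1) (b := n) (by omega)
  have h₂ := Int.emod_lt_of_pos (a - 1) (b := n) (by omega)
  rw [mem_Icc, modRep]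
  omega

lemma modRep_modRep_add {n : ℕ} (hn : 0 < n) (a c : ℤ) :
    modRep n (modRep n a + c) = modRep n (a + c) := by
  have h₁ := Int.emod_nonneg (a - 1) (b := n) (by omega)
  have h₂ : (modRep n a : ℤ) = a + -((a - 1) / n) * n := by
    have h₃ := Int.emod_add_mul_ediv (a - 1) n
    have h₄ : (modRep n a : ℤ) = (a - 1) % n + 1 := by rw [modRep]; omega
    linarith
  rw [h₂, show a + -((a - 1) / n) * n + c = a + c + -((a - 1) / n) * n by ring, modRep_add_mul]

lemma modRep_eq_of_sub_eq {n : ℕ} {a b : ℤ} (h : a = b + n) : modRep n a = modRep n b := by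
  rw [h, ← modRep_add_mul n b 1, one_mul]

lemma modRep_spec {n : ℕ} {a : ℤ} (h₁ : -n < a) (h₂ : a ≤ 2 * n) :
    (1 ≤ modRep n a ∧ modRep n a ≤ n) ∧
      ((modRep n a : ℤ) = a ∨ (modRep n a : ℤ) = a + n ∨ (modRep n a : ℤ) = a - n) := by
  refine ⟨mem_Icc.1 (modRep_mem_Icc (by omega) a), ?_⟩
  rw [modRep]
  obtain h | h | h : a ≤ 0 ∨ (1 ≤ a ∧ a ≤ n) ∨ n < a := by omega
  · rw [← Int.add_emod_right, Int.emod_eq_of_lt] <;> omega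
  · rw [Int.emod_eq_of_lt] <;> omega
  · rw [← Int.sub_emod_right, Int.emod_eq_of_lt] <;> omega

lemma modRep_ne {n : ℕ} {a b : ℤ} (h₁ : a < b) (h₂ : b < a + n) : modRep n a ≠ modRep n b := by
  intro h
  have h' : a - 1 ≡ b - 1 [ZMOD n] := by
    have h₃ := Int.emod_nonneg (a - 1) (b := n) (by omega)
    have h₄ := Int.emod_nonneg (b - 1) (b := n) (by omega)
    simp only [modRep] at h
    rw [Int.ModEq]
    omega
  have := Int.le_of_dvd (by omega) h'.dvd
  omega

/-- The triangle `{x, x + j, x + 2p}` modulo `3p + 1`. -/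
def tri (p : ℕ) (x j : ℤ) : Finset ℕ :=
  {modRep (3 * p + 1) x, modRep (3 * p + 1) (x + j), modRep (3 * p + 1) (x + 2 * p)}

lemma tri_eq {x j a b c : ℤ} (ha : a = x) (hb : b = x + j) (hc : c = x + 2 * p) :
    ({modRep (3 * p + 1) a, modRep (3 * p + 1) b, modRep (3 * p + 1) c} : Finset ℕ)
      = tri p x j := by
  rw [ha, hb, hc, tri]

lemma tri_modRep (x j : ℤ) : tri p (modRep (3 * p + 1) x) j = tri p x j := by
  have h := modRep_modRep_add (n := 3 * p + 1) (by omega) x 0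
  simp only [add_zero] at h
  rw [tri, modRep_modRep_add (by omega), modRep_modRep_add (by omega), h, tri]

lemma card_tri {x j : ℤ} (h₁ : 1 ≤ j) (h₂ : j ≤ p) : (tri p x j).card = 3 := by
  rw [tri, card_eq_three]
  exact ⟨_, _, _, modRep_ne (by omega) (by push_cast; omega),
    modRep_ne (by omega) (by push_cast; omega), modRep_ne (by omega) (by push_cast; omega), rfl⟩

/-- The pairs `(x, j)` for which `{x, x + j, x + 2p}` is a triangle of the complex. -/
def IsGen (p : ℕ) (x j : ℤ) : Prop :=
  1 ≤ j ∧ (j < p ∨ j = p ∧ 1 ≤ x ∧ x ≤ 2 * p)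

lemma IsGen.le {x j : ℤ} (h : IsGen p x j) : j ≤ p := by
  rcases h.2 with h | h <;> omega

lemma mem_hatDeltaC (hp : 2 ≤ p) {F : Finset ℕ} :
    F ∈ hatDeltaC p ↔ ∃ x j : ℤ, IsGen p x j ∧ F ⊆ tri p x j := by
  constructor
  · simp only [hatDeltaC, SigmaC, DeltaC, DeltaCinf, mem_union, mem_biUnion, mem_powerset,
      mem_product, mem_Icc, Prod.exists]
    rintro ((⟨i, hi, hF⟩ | ⟨i, j, ⟨hi, hj⟩, hF | hF⟩) | ⟨i, hi, hF | hF⟩)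
    · refine ⟨i - (p - 1), p - 1, ⟨by omega, by omega⟩, hF.trans_eq ?_⟩
      exact tri_eq (by ring) (by ring) (by ring)
    · refine ⟨i - j, j, ⟨by omega, by omega⟩, hF.trans_eq ?_⟩
      exact tri_eq (by ring) (by ring) (by ring)
    · refine ⟨i + p + 1, p - 1 - j, ⟨by omega, by omega⟩, hF.trans_eq ?_⟩
      rw [← modRep_eq_of_sub_eq (a := (i : ℤ) + p + 1 + 2 * p) (b := i) (by omega)]
      exact tri_eq (by ring) (by ring) (by ring)
    · refine ⟨i, p, ⟨by omega, by omega⟩, hF.trans_eq rfl⟩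
    · refine ⟨i + p, p, ⟨by omega, by omega⟩, hF.trans_eq ?_⟩
      exact tri_eq (by ring) (by ring) (by ring)
  · rintro ⟨x, j, ⟨hj, hjp⟩, hF⟩
    simp only [hatDeltaC, SigmaC, DeltaC, DeltaCinf, mem_union, mem_biUnion, mem_powerset,
      mem_product, mem_Icc, Prod.exists]
    obtain hj' | hj' | ⟨rfl, hx₁, hx₂⟩ : j ≤ p - 2 ∨ p - 1 = j ∨ (j = p ∧ 1 ≤ x ∧ x ≤ 2 * p) := by
      omega
    · refine .inl (.inr ⟨modRep (3 * p + 1) (x + j), j.toNat,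
        ⟨mem_Icc.1 (modRep_mem_Icc (by omega) _), by omega⟩, .inl (hF.trans_eq ?_)⟩)
      have hmod (c : ℤ) := modRep_modRep_add (n := 3 * p + 1) (by omega) (x + j) c
      have h₀ := hmod 0
      simp only [add_zero] at h₀
      rw [sub_eq_add_neg, hmod, hmod, h₀, Int.toNat_of_nonneg (by omega)]
      exact (tri_eq (by ring) (by ring) (by ring)).symm
    · refine .inl (.inl ⟨modRep (3 * p + 1) (x + j),
        mem_Icc.1 (modRep_mem_Icc (by omega) _), hF.trans_eq ?_⟩)
      have hmod (c : ℤ) := modRep_modRep_add (n := 3 * p + 1) (by omega) (x + j) c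
      have h₀ := hmod 0
      simp only [add_zero] at h₀
      rw [hj', sub_eq_add_neg, hmod, hmod, h₀]
      exact (tri_eq (by ring) rfl (by linarith)).symm
    · rcases le_or_gt x p with hxp | hxp
      · refine .inr ⟨x.toNat, by omega, .inl (hF.trans_eq ?_)⟩
        rw [Int.toNat_of_nonneg (by omega), tri]
      · refine .inr ⟨(x - p).toNat, by omega, .inr (hF.trans_eq ?_)⟩
        rw [Int.toNat_of_nonneg (by omega)]
        exact (tri_eq (by ring) (by ring) (by ring)).symm

lemma hatDeltaC_closed (hp : 2 ≤ p) : ∀ F ∈ hatDeltaC p, ∀ G ⊆ F, G ∈ hatDeltaC p := by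
  intro F hF G hG
  rw [mem_hatDeltaC hp] at hF ⊢
  obtain ⟨x, j, h, hF⟩ := hF
  exact ⟨x, j, h, hG.trans hF⟩

lemma hatDeltaC_subset (hp : 2 ≤ p) : ∀ F ∈ hatDeltaC p, F ⊆ Finset.Icc 1 (3 * p + 1) := by
  intro F hF
  obtain ⟨x, j, -, hF⟩ := (mem_hatDeltaC hp).1 hF
  refine hF.trans ?_
  simp [tri, insert_subset_iff, modRep_mem_Icc, -mem_Icc]

lemma hatDeltaC_pure (hp : 2 ≤ p) : ∀ F ∈ hatDeltaC p, ∃ G ∈ hatDeltaC p, F ⊆ G ∧ G.card = 3 := by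
  intro F hF
  obtain ⟨x, j, h, hF⟩ := (mem_hatDeltaC hp).1 hF
  exact ⟨_, (mem_hatDeltaC hp).2 ⟨x, j, h, Subset.rfl⟩, hF, card_tri h.1 h.le⟩

lemma hatDeltaC_card_le (hp : 2 ≤ p) : ∀ F ∈ hatDeltaC p, F.card ≤ 3 := by
  intro F hF
  obtain ⟨G, -, hFG, hG⟩ := hatDeltaC_pure hp F hF
  exact hG ▸ card_le_card hFG

lemma card_triangles_le (hp : 2 ≤ p) : (facesOf (hatDeltaC p) 3).card ≤ 3 * p ^ 2 - 1 := by
  have hsub : facesOf (hatDeltaC p) 3 ⊆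
      (Finset.Icc (1 : ℤ) (3 * p + 1 : ℕ) ×ˢ Finset.Icc (1 : ℤ) (p - 1)).image
        (fun q => tri p q.1 q.2) ∪ (Finset.Icc (1 : ℤ) (2 * p)).image (fun x => tri p x p) := by
    intro F hF
    rw [facesOf, mem_filter, mem_hatDeltaC hp] at hF
    obtain ⟨⟨x, j, h, hFx⟩, hF3⟩ := hF
    obtain rfl := eq_of_subset_of_card_le hFx (by rw [card_tri h.1 h.le, hF3])
    rw [mem_union, mem_image, mem_image]
    rcases h.2 with hj | ⟨rfl, hx⟩
    · refine .inl ⟨(modRep (3 * p + 1) x, j), ?_, tri_modRep x j⟩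
      have := mem_Icc.1 (modRep_mem_Icc (n := 3 * p + 1) (by omega) x)
      have := h.1
      simp only [mem_product, mem_Icc]
      omega
    · exact .inr ⟨x, mem_Icc.2 hx, rfl⟩
  refine (card_le_card hsub).trans ((card_union_le _ _).trans
    ((add_le_add card_image_le card_image_le).trans ?_))
  rw [card_product, Int.card_Icc, Int.card_Icc, Int.card_Icc]
  obtain ⟨q, rfl⟩ := Nat.exists_eq_add_of_le' hp
  have h₁ : (((3 * (q + 2) + 1 : ℕ) : ℤ) + 1 - 1).toNat = 3 * q + 7 := by omega
  have h₂ : (((q + 2 : ℕ) : ℤ) - 1 + 1 - 1).toNat = q + 1 := by omega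
  have h₃ : (2 * ((q + 2 : ℕ) : ℤ) + 1 - 1).toNat = 2 * q + 4 := by omega
  rw [h₁, h₂, h₃]
  refine Nat.le_sub_of_add_le (le_of_eq ?_)
  ring

lemma pair_notMem (hp : 2 ≤ p) : ({p, 3 * p + 1} : Finset ℕ) ∉ hatDeltaC p := by
  intro h
  obtain ⟨x, j, ⟨hj, hx⟩, h⟩ := (mem_hatDeltaC hp).1 h
  rw [← tri_modRep] at h
  have hy := modRep_mem_Icc (n := 3 * p + 1) (by omega) x
  have hxy : j < p ∨ j = p ∧ 1 ≤ modRep (3 * p + 1) x ∧ modRep (3 * p + 1) x ≤ 2 * p := by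
    refine hx.imp_right fun hx => ⟨hx.1, ?_⟩
    have := modRep_spec (n := 3 * p + 1) (a := x) (by omega) (by omega)
    omega
  generalize modRep (3 * p + 1) x = y at h hy hxy
  rw [mem_Icc] at hy
  have h₁ := modRep_spec (n := 3 * p + 1) (a := y) (by omega) (by omega)
  have h₂ := modRep_spec (n := 3 * p + 1) (a := y + j) (by omega) (by omega)
  have h₃ := modRep_spec (n := 3 * p + 1) (a := y + 2 * p) (by omega) (by omega)
  simp only [tri, insert_subset_iff, singleton_subset_iff, mem_insert, mem_singleton] at h
  omega

lemma edge_mem (hp : 2 ≤ p) {u v : ℕ} (hu : 1 ≤ u) (huv : u < v) (hv : v ≤ 3 * p + 1)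
    (h : ¬(u = p ∧ v = 3 * p + 1)) : ({u, v} : Finset ℕ) ∈ hatDeltaC p := by
  suffices ∃ x j : ℤ, IsGen p x j ∧
      u ∈ tri p x j ∧ v ∈ tri p x j by
    obtain ⟨x, j, hx, hux, hvx⟩ := this
    exact (mem_hatDeltaC hp).2 ⟨x, j, hx, by simp [insert_subset_iff, hux, hvx]⟩
  have hmu : modRep (3 * p + 1) u = u := modRep_natCast hu (by omega)
  have hmv : modRep (3 * p + 1) v = v := modRep_natCast (by omega) hv
  have hmu' : modRep (3 * p + 1) (u + (3 * p + 1 : ℕ)) = u := by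
    rw [modRep_eq_of_sub_eq rfl, hmu]
  obtain hd | hd | hd | hd | hd | hd : v < u + p ∨ v = u + p ∨ (u + p < v ∧ v < u + 2 * p) ∨
      v = u + 2 * p ∨ v = u + 2 * p + 1 ∨ u + 2 * p + 2 ≤ v := by omega
  · refine ⟨u, v - u, ⟨by omega, by omega⟩, ?_, ?_⟩
    · simp [tri, hmu]
    · simp [tri, hmv]
  · rcases le_or_gt u (2 * p) with hu2 | hu2
    · refine ⟨u, p, ⟨by omega, by omega⟩, ?_, ?_⟩
      · simp [tri, hmu]
      · have : (u : ℤ) + p = v := by omega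
        simp [tri, this, hmv]
    · refine ⟨u - p, p, ⟨by omega, by omega⟩, ?_, ?_⟩
      · simp [tri, hmu]
      · have : (u : ℤ) - p + 2 * p = v := by omega
        simp [tri, this, hmv]
  · refine ⟨v - 2 * p, u + 2 * p - v, ⟨by omega, by omega⟩, ?_, ?_⟩
    · have : (v : ℤ) - 2 * p + (u + 2 * p - v) = u := by ring
      simp [tri, this, hmu]
    · simp [tri, hmv]
  · refine ⟨u, 1, ⟨by omega, by omega⟩, ?_, ?_⟩
    · simp [tri, hmu]
    · have : (u : ℤ) + 2 * p = v := by omega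
      simp [tri, this, hmv]
  · refine ⟨v - p, p, ⟨by omega, by omega⟩, ?_, ?_⟩
    · have : (v : ℤ) - p + 2 * p = u + (3 * p + 1 : ℕ) := by omega
      simp only [tri, this, hmu', mem_insert, mem_singleton, or_true]
    · simp [tri, hmv]
  · refine ⟨v, u + 3 * p + 1 - v, ⟨by omega, by omega⟩, ?_, ?_⟩
    · have : (v : ℤ) + (u + 3 * p + 1 - v) = u + (3 * p + 1 : ℕ) := by omega
      simp only [tri, this, hmu', mem_insert, mem_singleton, true_or, or_true]
    · simp [tri, hmv]

lemma vertex_mem (hp : 2 ≤ p) {v : ℕ} (hv : v ∈ Finset.Icc 1 (3 * p + 1)) :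
    ({v} : Finset ℕ) ∈ hatDeltaC p := by
  rw [mem_Icc] at hv
  refine (mem_hatDeltaC hp).2 ⟨v, 1, ⟨by omega, by omega⟩, ?_⟩
  simp [tri, modRep_natCast hv.1 hv.2]

lemma facesOf_one (hp : 2 ≤ p) :
    (facesOf (hatDeltaC p) 1).card = 3 * p + 1 := by
  have h : facesOf (hatDeltaC p) 1 = (Finset.Icc 1 (3 * p + 1)).powersetCard 1 := by
    ext F
    rw [facesOf, mem_filter, mem_powersetCard]
    refine and_congr_left fun hF => ⟨hatDeltaC_subset hp F, fun h => ?_⟩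
    obtain ⟨v, rfl⟩ := card_eq_one.1 hF
    exact vertex_mem hp (singleton_subset_iff.1 h)
  rw [h, card_powersetCard, Nat.card_Icc, Nat.choose_one_right, Nat.add_sub_cancel]

lemma facesOf_two (hp : 2 ≤ p) :
    (facesOf (hatDeltaC p) 2).card = (3 * p + 1).choose 2 - 1 := by
  have h : facesOf (hatDeltaC p) 2 =
      ((Finset.Icc 1 (3 * p + 1)).powersetCard 2).erase {p, 3 * p + 1} := by
    ext F
    rw [facesOf, mem_filter, mem_erase, mem_powersetCard]
    constructor
    · rintro ⟨hF, hF2⟩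
      exact ⟨fun h => pair_notMem hp (h ▸ hF), hatDeltaC_subset hp F hF, hF2⟩
    · rintro ⟨hne, hsub, hF2⟩
      refine ⟨?_, hF2⟩
      obtain ⟨u, v, huv, rfl⟩ := card_eq_two.1 hF2
      simp only [insert_subset_iff, singleton_subset_iff, mem_Icc] at hsub
      rcases huv.lt_or_gt with h | h
      · refine edge_mem hp hsub.1.1 h hsub.2.2 ?_
        rintro ⟨rfl, rfl⟩
        exact hne rfl
      · rw [pair_comm]
        refine edge_mem hp hsub.2.1 h hsub.1.2 ?_
        rintro ⟨rfl, rfl⟩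
        exact hne (pair_comm _ _)
  rw [h, card_erase_of_mem, card_powersetCard, Nat.card_Icc, Nat.add_sub_cancel]
  rw [mem_powersetCard, card_pair (by omega)]
  simp only [insert_subset_iff, singleton_subset_iff, mem_Icc, and_true]
  omega

/-- Two vertices other than `v` of a triangle containing `v` form an edge of the link of `v`. -/
lemma pair_mem_link (hp : 2 ≤ p) {x j a b v : ℤ} (hx : IsGen p x j)
    (ha : modRep (3 * p + 1) a ∈ tri p x j) (hb : modRep (3 * p + 1) b ∈ tri p x j)
    (hv : modRep (3 * p + 1) v ∈ tri p x j)
    (hav : modRep (3 * p + 1) a ≠ modRep (3 * p + 1) v)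
    (hbv : modRep (3 * p + 1) b ≠ modRep (3 * p + 1) v) :
    ({modRep (3 * p + 1) a, modRep (3 * p + 1) b} : Finset ℕ) ∈
      link (hatDeltaC p) {modRep (3 * p + 1) v} := by
  rw [mem_link (hatDeltaC_closed hp), mem_hatDeltaC hp]
  refine ⟨by simp [hav.symm, hbv.symm], x, j, hx, ?_⟩
  simp [insert_subset_iff, ha, hb, hv]

/-- The three edges of the links of its vertices determined by a triangle. -/
lemma link_edges (hp : 2 ≤ p) {x j : ℤ} (hx : IsGen p x j) :
    ({modRep (3 * p + 1) (x + j), modRep (3 * p + 1) (x + 2 * p)} : Finset ℕ) ∈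
        link (hatDeltaC p) {modRep (3 * p + 1) x} ∧
      ({modRep (3 * p + 1) x, modRep (3 * p + 1) (x + 2 * p)} : Finset ℕ) ∈
        link (hatDeltaC p) {modRep (3 * p + 1) (x + j)} ∧
      ({modRep (3 * p + 1) x, modRep (3 * p + 1) (x + j)} : Finset ℕ) ∈
        link (hatDeltaC p) {modRep (3 * p + 1) (x + 2 * p)} := by
  have h₁ := hx.1
  have h₂ := hx.le
  have hxj : modRep (3 * p + 1) x ≠ modRep (3 * p + 1) (x + j) :=
    modRep_ne (by omega) (by omega)
  have hxp : modRep (3 * p + 1) x ≠ modRep (3 * p + 1) (x + 2 * p) :=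
    modRep_ne (by omega) (by omega)
  have hjp : modRep (3 * p + 1) (x + j) ≠ modRep (3 * p + 1) (x + 2 * p) :=
    modRep_ne (by omega) (by omega)
  refine ⟨pair_mem_link hp hx ?_ ?_ ?_ hxj.symm hxp.symm,
    pair_mem_link hp hx ?_ ?_ ?_ hxj hjp.symm, pair_mem_link hp hx ?_ ?_ ?_ hxp hjp⟩ <;>
  simp [tri]

/-- The vertices of the link of `v` other than `v + p` and `v - p` reach `v + p + 1`. -/
lemma reaches_aux (hp : 2 ≤ p) {v t : ℤ} (ht₁ : 1 ≤ t) (ht₂ : t ≤ 3 * p) (htp : t ≠ p)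
    (htp' : t ≠ 2 * p + 1) :
    Relation.ReflTransGen
      (fun a b : ℕ => {a, b} ∈ link (hatDeltaC p) {modRep (3 * p + 1) v})
      (modRep (3 * p + 1) (v + t)) (modRep (3 * p + 1) (v + p + 1)) := by
  have hfar : ∀ s : ℤ, p + 1 ≤ s → s ≤ 2 * p → Relation.ReflTransGen
      (fun a b : ℕ => {a, b} ∈ link (hatDeltaC p) {modRep (3 * p + 1) v})
      (modRep (3 * p + 1) (v + s)) (modRep (3 * p + 1) (v + p + 1)) := by
    intro s hs₁ hs₂
    rcases hs₁.eq_or_lt with rfl | hs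
    · rw [← add_assoc]
    · refine .single ?_
      have h := (link_edges hp (x := v + p + 1) (j := s - p - 1) ⟨by omega, by omega⟩).2.2
      rw [modRep_eq_of_sub_eq (a := v + p + 1 + 2 * p) (b := v) (by omega), pair_comm] at h
      rwa [show v + p + 1 + (s - p - 1) = v + s by ring] at h
  obtain h | h | h : t < p ∨ (p < t ∧ t ≤ 2 * p) ∨ 2 * p + 2 ≤ t := by omega
  · exact .head (link_edges hp ⟨ht₁, by omega⟩).1 (hfar _ (by omega) le_rfl)
  · exact hfar t (by omega) (by omega)
  · have h₁ := (link_edges hp (x := v + t - (3 * p + 1 : ℕ)) (j := 3 * p + 1 - t)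
      ⟨by omega, by omega⟩).2.1
    rw [← modRep_eq_of_sub_eq (a := v + t) (b := v + t - (3 * p + 1 : ℕ)) (by omega)] at h₁
    rw [show v + t - (3 * p + 1 : ℕ) + (3 * p + 1 - t) = v by push_cast; ring,
      show v + t - (3 * p + 1 : ℕ) + 2 * p = v + (t - p - 1) by push_cast; ring] at h₁
    exact .head h₁ (hfar _ (by omega) (by omega))

/-- The vertices `v + p` and `v - p` reach `v + p + 1` in the link of `v` unless the edge joining
them to `v` is the missing edge. -/
lemma reaches_add_p (hp : 2 ≤ p) {v : ℤ} (hv₁ : 1 ≤ v) (hv₂ : v ≤ 3 * p + 1) :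
    (v ≠ 3 * p + 1 → Relation.ReflTransGen
      (fun a b : ℕ => {a, b} ∈ link (hatDeltaC p) {modRep (3 * p + 1) v})
      (modRep (3 * p + 1) (v + p)) (modRep (3 * p + 1) (v + p + 1))) ∧
    (v ≠ p → Relation.ReflTransGen
      (fun a b : ℕ => {a, b} ∈ link (hatDeltaC p) {modRep (3 * p + 1) v})
      (modRep (3 * p + 1) (v - p)) (modRep (3 * p + 1) (v + p + 1))) := by
  have hplus : v ≤ 2 * p → Relation.ReflTransGen
      (fun a b : ℕ => {a, b} ∈ link (hatDeltaC p) {modRep (3 * p + 1) v})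
      (modRep (3 * p + 1) (v + p)) (modRep (3 * p + 1) (v + p + 1)) := fun h =>
    .head (link_edges hp ⟨by omega, .inr ⟨rfl, hv₁, h⟩⟩).1
      (reaches_aux hp (by omega) (by omega) (by omega) (by omega))
  have hminus : 2 * p + 1 ≤ v → Relation.ReflTransGen
      (fun a b : ℕ => {a, b} ∈ link (hatDeltaC p) {modRep (3 * p + 1) v})
      (modRep (3 * p + 1) (v - p)) (modRep (3 * p + 1) (v + p + 1)) := by
    intro h
    have h₁ := (link_edges hp (x := v - 2 * p) (j := p) ⟨by omega, by omega⟩).2.2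
    rw [← modRep_eq_of_sub_eq (a := v + p + 1) (b := v - 2 * p) (by omega),
      show v - 2 * p + p = v - p by ring, sub_add_cancel, pair_comm] at h₁
    exact .single h₁
  have hmid : p + 1 ≤ v → v ≤ 3 * p →
      ({modRep (3 * p + 1) (v - p), modRep (3 * p + 1) (v + p)} : Finset ℕ) ∈
        link (hatDeltaC p) {modRep (3 * p + 1) v} := by
    intro h h'
    have h₁ := (link_edges hp (x := v - p) (j := p) ⟨by omega, by omega⟩).2.1
    rwa [sub_add_cancel, show v - p + 2 * p = v + p by ring] at h₁
  refine ⟨fun h => ?_, fun h => ?_⟩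
  · rcases le_or_gt v (2 * p) with h' | h'
    · exact hplus h'
    · refine .head ?_ (hminus h')
      rw [pair_comm]
      exact hmid (by omega) (by omega)
  · obtain h' | h' | h' : v < p ∨ (p + 1 ≤ v ∧ v ≤ 2 * p) ∨ 2 * p < v := by omega
    · have h₁ := (link_edges hp (x := v + p + 1) (j := p) ⟨by omega, by omega⟩).2.2
      rw [modRep_eq_of_sub_eq (a := v + p + 1 + 2 * p) (b := v) (by omega),
        modRep_eq_of_sub_eq (a := v + p + 1 + p) (b := v - p) (by push_cast; ring),
        pair_comm] at h₁
      exact .single h₁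
    · exact .head (hmid h'.1 (by omega)) (hplus h'.2)
    · exact hminus h'

lemma reachesRoot_link (hp : 2 ≤ p) {v : ℕ} (hv : v ∈ Finset.Icc 1 (3 * p + 1)) :
    ReachesRoot (link (hatDeltaC p) {v}) (modRep (3 * p + 1) (v + p + 1)) := by
  intro u hu
  rw [mem_link (hatDeltaC_closed hp), disjoint_singleton, singleton_union] at hu
  obtain ⟨hne, hu⟩ := hu
  have huI := hatDeltaC_subset hp _ hu (mem_insert_self _ _)
  rw [mem_Icc] at hv huI
  have hmv := modRep_natCast hv.1 hv.2
  have hmu := modRep_natCast huI.1 huI.2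
  have h₁ : ¬(u = p ∧ v = 3 * p + 1) := by
    rintro ⟨rfl, rfl⟩
    exact pair_notMem hp hu
  have h₂ : ¬(v = p ∧ u = 3 * p + 1) := by
    rintro ⟨rfl, rfl⟩
    rw [pair_comm] at hu
    exact pair_notMem hp hu
  obtain ⟨t, ht₁, ht₂, ht, htv⟩ : ∃ t : ℤ, 1 ≤ t ∧ t ≤ 3 * p ∧
      modRep (3 * p + 1) (v + t) = u ∧ (v + t = u ∨ v + t = u + (3 * p + 1 : ℕ)) := by
    rcases hne.lt_or_gt with h | h
    · refine ⟨u + (3 * p + 1 : ℕ) - v, by omega, by omega, ?_, by omega⟩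
      rw [modRep_eq_of_sub_eq (b := u) (by ring), hmu]
    · refine ⟨u - v, by omega, by omega, ?_, by omega⟩
      rw [add_sub_cancel, hmu]
  have hadd := reaches_add_p hp (v := v) (by omega) (by omega)
  rw [hmv] at hadd
  rw [← ht]
  by_cases htp : t = p
  · rw [htp]
    exact hadd.1 (by omega)
  by_cases htp' : t = 2 * p + 1
  · rw [modRep_eq_of_sub_eq (b := (v : ℤ) - p) (by omega)]
    exact hadd.2 (by omega)
  have := reaches_aux hp (v := v) ht₁ ht₂ htp htp'
  rwa [hmv] at this

lemma root_mem_link (hp : 2 ≤ p) {v : ℕ} (hv : v ∈ Finset.Icc 1 (3 * p + 1)) :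
    {modRep (3 * p + 1) (v + p + 1)} ∈ link (hatDeltaC p) {v} := by
  rw [mem_Icc] at hv
  have h := (link_edges hp (x := v + p + 1) (j := 1) ⟨by omega, by omega⟩).2.2
  rw [modRep_eq_of_sub_eq (a := (v : ℤ) + p + 1 + 2 * p) (b := v) (by omega),
    modRep_natCast hv.1 hv.2] at h
  exact link_subset_closed (hatDeltaC_closed hp) _ _ h _ (by simp)

end Residues

/-- **Lemma 3.8(i).** For `n = 3p+1`, `Δ̂` is Buchsbaum, link-acyclic,
`h(Δ̂) = (1, n-3, 3M, -M)` where `M = (C(n-2,2)-1)/3`, and `{p, n} ∉ Δ̂`. -/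
theorem stmt17 (K : Type) [Field K] (p : ℕ) (hp : 2 ≤ p) :
    IsBuchsbaum K (hatDeltaC p) ∧ IsLinkAcyclic K (hatDeltaC p) ∧
      hVector3 (hatDeltaC p) 1 (((3 * p + 1 : ℕ) : ℤ) - 3)
        (3 * ((((3 * p + 1 - 2).choose 2 - 1) / 3 : ℕ) : ℤ)) (-((((3 * p + 1 - 2).choose 2 - 1) / 3 : ℕ) : ℤ)) ∧
      ({p, 3 * p + 1} : Finset ℕ) ∉ hatDeltaC p := by
  obtain ⟨q, rfl⟩ := Nat.exists_eq_add_of_le' hp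
  obtain ⟨c, hc⟩ : ∃ c, q * (q + 1) = 2 * c := (Nat.even_mul_succ_self q).two_dvd
  have h₁ := facesOf_one hp
  have h₂ : (facesOf (hatDeltaC (q + 2)) 2).card = 9 * c + 15 * q + 20 := by
    rw [facesOf_two hp, Nat.choose_two_right, Nat.add_sub_cancel,
      show (3 * (q + 2) + 1) * (3 * (q + 2)) = 2 * (9 * c + 15 * q + 21) by nlinarith,
      Nat.mul_div_cancel_left _ two_pos]
    rfl
  have h₃ : (facesOf (hatDeltaC (q + 2)) 3).card ≤ 6 * c + 9 * q + 11 :=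
    (card_triangles_le hp).trans (by rw [tsub_le_iff_right]; nlinarith)
  have hM : ((3 * (q + 2) + 1 - 2).choose 2 - 1) / 3 = 3 * c + 3 * q + 3 := by
    rw [Nat.choose_two_right, show 3 * (q + 2) + 1 - 2 = 3 * q + 5 by omega,
      show (3 * q + 5) * (3 * q + 5 - 1) = 2 * (9 * c + 9 * q + 10) by
        rw [show 3 * q + 5 - 1 = 3 * q + 4 by omega]; nlinarith,
      Nat.mul_div_cancel_left _ two_pos]
    omega
  have hconn : ∀ v ∈ Finset.Icc 1 (3 * (q + 2) + 1), ∃ r,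
      ReachesRoot (link (hatDeltaC (q + 2)) {v}) r ∧ {r} ∈ link (hatDeltaC (q + 2)) {v} :=
    fun v hv => ⟨_, reachesRoot_link hp hv, root_mem_link hp hv⟩
  have hcard : 3 * (facesOf (hatDeltaC (q + 2)) 3).card + (Finset.Icc 1 (3 * (q + 2) + 1)).card
      ≤ 2 * (facesOf (hatDeltaC (q + 2)) 2).card := by
    rw [h₂, Nat.card_Icc]
    omega
  have h₃' := (card_facesOf_link_of_connected (hatDeltaC_closed hp) (hatDeltaC_subset hp)
    (fun v hv => (hconn v hv).imp fun _ h => h.1) hcard).1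
  rw [h₂, Nat.card_Icc] at h₃'
  obtain ⟨hB, hL⟩ := isBuchsbaum_and_isLinkAcyclic K (hatDeltaC_closed hp) (hatDeltaC_subset hp)
    (hatDeltaC_pure hp) (hatDeltaC_card_le hp) hconn hcard
  refine ⟨hB, hL, ?_, pair_notMem hp⟩
  rw [hM]
  simp only [hVector3, hVec, sum_range_succ, range_zero, sum_empty, fVec, h₁, h₂]
  norm_num [Nat.choose]
  omega
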